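/- Affine equivariance of the naive quantization: for every h in the affine family {1, x, ξ₁ξ₂, ξ₁, ξ₂} ⊂ A and homogeneous F₁, F₂ ∈ A of the same parity, the following exact identities (no lower-order remainder) hold: for every integer k ≥ 1, 𝓛_{X_h}(F₁∂_x^k + F₂∂_x^{k−1}D̄₁D̄₂) = (L^{μ−λ−k}_{X_h}(F₁))∂_x^k + (L^{μ−λ−k}_{X_h}(F₂))∂_x^{k−1}D̄₁D̄₂, and for every half-integer k = ℓ + 1/2 (ℓ ≥ 0 integer), 𝓛_{X_h}(F₁∂_x^ℓD̄₁ + F₂∂_x^ℓD̄₂) = (L^{μ−λ−k}_{X_h}(F₁) − (1/2)D̄₁D̄₂(h)·F₂)∂_x^ℓD̄₁ + (L^{μ−λ−k}_{X_h}(F₂) + (1/2)D̄₁D̄₂(h)·F₁)∂_x^ℓD̄₂. Consequently D^k_{λμ} is isomorphic to the symbol module S^k_{μ−λ} as a module over the affine Lie superalgebra Aff(2|2). -/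

import Mathlib

/-!
Functions on the supercircle `S^{1|2}`: the superalgebra
`A = C^∞(ℝ,ℂ)[ξ₁,ξ₂]`.  An element `f = f₀ + ξ₁f₁ + ξ₂f₂ + ξ₁ξ₂f₁₂`
is encoded by the 4-tuple `(f₀, f₁, f₂, f₁₂)` of functions `ℝ → ℂ`.
-/

noncomputable section

abbrev SA : Type := (ℝ → ℂ) × (ℝ → ℂ) × (ℝ → ℂ) × (ℝ → ℂ)

namespace SA

def a0 (f : SA) : ℝ → ℂ := f.1
def a1 (f : SA) : ℝ → ℂ := f.2.1
def a2 (f : SA) : ℝ → ℂ := f.2.2.1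
def a12 (f : SA) : ℝ → ℂ := f.2.2.2

/-- all four component functions are smooth -/
def Smooth (f : SA) : Prop :=
  ContDiff ℝ (⊤ : ℕ∞) (a0 f) ∧ ContDiff ℝ (⊤ : ℕ∞) (a1 f) ∧ ContDiff ℝ (⊤ : ℕ∞) (a2 f) ∧ ContDiff ℝ (⊤ : ℕ∞) (a12 f)

/-- the (super-commutative) product of the Grassmann algebra `A`;
`ξᵢ² = 0`, `ξ₁ξ₂ = -ξ₂ξ₁`. -/
def gmul (f g : SA) : SA :=
  (a0 f * a0 g,
   a0 f * a1 g + a1 f * a0 g,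
   a0 f * a2 g + a2 f * a0 g,
   a0 f * a12 g + a12 f * a0 g + a1 f * a2 g - a2 f * a1 g)

scoped infixl:70 " ⊙ " => SA.gmul

/-- the unit `1 ∈ A` -/
def one : SA := (1, 0, 0, 0)
/-- the even coordinate `x ∈ A` -/
def xx : SA := (fun t => (t : ℂ), 0, 0, 0)
/-- the odd coordinate `ξ₁ ∈ A` -/
def xi1 : SA := (0, 1, 0, 0)
/-- the odd coordinate `ξ₂ ∈ A` -/
def xi2 : SA := (0, 0, 1, 0)

/-- `∂_x`, differentiating the coefficients -/
def dx (f : SA) : SA := (deriv (a0 f), deriv (a1 f), deriv (a2 f), deriv (a12 f))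
/-- the left Grassmann derivative `∂_{ξ₁}` -/
def dxi1 (f : SA) : SA := (a1 f, 0, a12 f, 0)
/-- the left Grassmann derivative `∂_{ξ₂}` -/
def dxi2 (f : SA) : SA := (a2 f, -a12 f, 0, 0)
/-- `D̄₁ = ∂_{ξ₁} - ξ₁∂_x` -/
def D1 (f : SA) : SA := dxi1 f - xi1 ⊙ dx f
/-- `D̄₂ = ∂_{ξ₂} - ξ₂∂_x` -/
def D2 (f : SA) : SA := dxi2 f - xi2 ⊙ dx f

def IsEven (f : SA) : Prop := a1 f = 0 ∧ a2 f = 0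
def IsOdd (f : SA) : Prop := a0 f = 0 ∧ a12 f = 0
/-- `f` is homogeneous of parity `b` (`false` = even, `true` = odd) -/
def Homog (b : Bool) (f : SA) : Prop := if b then IsOdd f else IsEven f
/-- `(-1)^b` -/
def sgn (b : Bool) : ℂ := if b then -1 else 1
/-- `(-1)^(b*c)` -/
def sgn2 (b c : Bool) : ℂ := if b && c then -1 else 1

/-- the contact vector field `X_f` (with `f` homogeneous of parity `b`)
applied to `g`:  `X_f(g) = f ∂_x g - (-1)^{p(f)} ½ (D̄₁(f)D̄₁(g) + D̄₂(f)D̄₂(g))` -/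
def XV (b : Bool) (f : SA) (g : SA) : SA :=
  f ⊙ dx g - (sgn b * (2 : ℂ)⁻¹) • (D1 f ⊙ D1 g + D2 f ⊙ D2 g)

/-- the Lie derivative `L^λ_{X_f} = X_f + λ f'` on `λ`-densities -/
def Lden (b : Bool) (f : SA) (lam : ℂ) (g : SA) : SA :=
  XV b f g + lam • (dx f ⊙ g)

/-- the contact bracket `{f,g} = fg' - f'g - (-1)^{p(f)} ½ (D̄₁(f)D̄₁(g) + D̄₂(f)D̄₂(g))` -/
def cbr (b : Bool) (f g : SA) : SA :=
  f ⊙ dx g - dx f ⊙ g - (sgn b * (2 : ℂ)⁻¹) • (D1 f ⊙ D1 g + D2 f ⊙ D2 g)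

/-- the Lie derivative `𝓛_{X_f}(T) = L^μ_{X_f}∘T - (-1)^{p(f)p(T)} T∘L^λ_{X_f}`
of a homogeneous operator `T` of parity `bT` from `λ`- to `μ`-densities -/
def LieD (bf : Bool) (f : SA) (lam mu : ℂ) (bT : Bool) (T : SA → SA) : SA → SA :=
  fun g => Lden bf f mu (T g) - sgn2 bf bT • T (Lden bf f lam g)

def applyIf (b : Bool) (F : SA → SA) (g : SA) : SA := if b then F g else g

/-- the monomial operator `∂_x^ℓ D̄₁^m D̄₂^n` -/
def monoD (l : ℕ) (m n : Bool) (g : SA) : SA := dx^[l] (applyIf m D1 (applyIf n D2 g))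

def bnat (b : Bool) : ℕ := if b then 1 else 0

/-- membership in `D^{K/2}_{λμ}`: differential operators
`Σ a_{ℓ,m,n} ∂_x^ℓ D̄₁^m D̄₂^n` of contact order `ℓ + m/2 + n/2 ≤ K/2`. -/
def InD (K : ℕ) (T : SA → SA) : Prop :=
  ∃ a : ℕ → Bool → Bool → SA,
    (∀ l m n, Smooth (a l m n)) ∧
    (∀ l m n, ¬ (2 * l + bnat m + bnat n ≤ K) → a l m n = 0) ∧
    (∀ g, Smooth g →
      T g = ∑ l ∈ Finset.range (K + 1), ∑ m : Bool, ∑ n : Bool, a l m n ⊙ monoD l m n g)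

end SA

namespace SA

/-- `h` is one of the contact Hamiltonians `{1, x, ξ₁ξ₂; ξ₁, ξ₂}` spanning the
affine Lie superalgebra `Aff(2|2)`, with its parity `bh`. -/
def inAff (bh : Bool) (h : SA) : Prop :=
  (bh = false ∧ (h = one ∨ h = xx ∨ h = xi1 ⊙ xi2)) ∨
  (bh = true ∧ (h = xi1 ∨ h = xi2))

end SA

open SA

namespace SA

theorem differentiable_of_contDiff {u : ℝ → ℂ} (hu : ContDiff ℝ (⊤ : ℕ∞) u) : Differentiable ℝ u :=
  hu.differentiable (by simp)

theorem contDiff_deriv {u : ℝ → ℂ} (hu : ContDiff ℝ (⊤ : ℕ∞) u) :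
    ContDiff ℝ (⊤ : ℕ∞) (deriv u) :=
  (contDiff_infty_iff_deriv.mp hu).2

@[ext]
theorem ext' {f g : SA} (h0 : ∀ t, a0 f t = a0 g t) (h1 : ∀ t, a1 f t = a1 g t)
    (h2 : ∀ t, a2 f t = a2 g t) (h12 : ∀ t, a12 f t = a12 g t) : f = g :=
  Prod.ext (funext h0) (Prod.ext (funext h1) (Prod.ext (funext h2) (funext h12)))

theorem D1_eq (g : SA) : D1 g = (a1 g, -deriv (a0 g), a12 g, -deriv (a2 g)) := by
  simp [D1, dxi1, gmul, xi1, SA.dx, a0, a1, a2, a12]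

theorem D2_eq (g : SA) : D2 g = (a2 g, -a12 g, -deriv (a0 g), deriv (a1 g)) := by
  simp [D2, dxi2, gmul, xi2, SA.dx, a0, a1, a2, a12]

/-! ### The Grassmann product -/

theorem gmul_add (f g h : SA) : f ⊙ (g + h) = f ⊙ g + f ⊙ h := by
  ext t <;> simp [SA.gmul, a0, a1, a2, a12] <;> ring

theorem gmul_sub (f g h : SA) : f ⊙ (g - h) = f ⊙ g - f ⊙ h := by
  ext t <;> simp [SA.gmul, a0, a1, a2, a12] <;> ring

theorem add_gmul (f g h : SA) : (f + g) ⊙ h = f ⊙ h + g ⊙ h := by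
  ext t <;> simp [SA.gmul, a0, a1, a2, a12] <;> ring

theorem sub_gmul (f g h : SA) : (f - g) ⊙ h = f ⊙ h - g ⊙ h := by
  ext t <;> simp [SA.gmul, a0, a1, a2, a12] <;> ring

theorem gmul_smul (c : ℂ) (f g : SA) : f ⊙ (c • g) = c • (f ⊙ g) := by
  ext t <;> simp [SA.gmul, a0, a1, a2, a12] <;> ring

theorem smul_gmul (c : ℂ) (f g : SA) : (c • f) ⊙ g = c • (f ⊙ g) := by
  ext t <;> simp [SA.gmul, a0, a1, a2, a12] <;> ring

theorem gmul_neg (f g : SA) : f ⊙ (-g) = -(f ⊙ g) := by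
  simpa using gmul_smul (-1) f g

theorem neg_gmul (f g : SA) : (-f) ⊙ g = -(f ⊙ g) := by
  simpa using smul_gmul (-1) f g

theorem zero_gmul (f : SA) : (0 : SA) ⊙ f = 0 := by
  simpa using smul_gmul 0 0 f

theorem one_gmul (f : SA) : one ⊙ f = f := by
  ext t <;> simp [SA.gmul, one, a0, a1, a2, a12]

theorem gmul_assoc (f g h : SA) : f ⊙ g ⊙ h = f ⊙ (g ⊙ h) := by
  ext t <;> simp [SA.gmul, a0, a1, a2, a12] <;> ring

/-- Supercommutativity of the Grassmann product. -/
theorem gmul_comm {b c : Bool} {F G : SA} (hF : Homog b F) (hG : Homog c G) :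
    F ⊙ G = sgn2 b c • (G ⊙ F) := by
  obtain ⟨F0, F1, F2, F3⟩ := F
  obtain ⟨G0, G1, G2, G3⟩ := G
  cases b <;> cases c <;>
    simp only [Homog, IsEven, IsOdd, a0, a1, a2, a12, if_true, if_false, Bool.false_eq_true]
      at hF hG <;>
    obtain ⟨rfl, rfl⟩ := hF <;> obtain ⟨rfl, rfl⟩ := hG <;>
    ext t <;> simp [SA.gmul, a0, a1, a2, a12, sgn2] <;> ring

/-! ### Smoothness -/

theorem Smooth.dx {g : SA} (hg : Smooth g) : Smooth (dx g) :=
  ⟨contDiff_deriv hg.1, contDiff_deriv hg.2.1, contDiff_deriv hg.2.2.1, contDiff_deriv hg.2.2.2⟩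

theorem Smooth.iterate_dx {g : SA} (hg : Smooth g) (k : ℕ) : Smooth (SA.dx^[k] g) := by
  induction k with
  | zero => exact hg
  | succ k ih => rw [Function.iterate_succ_apply']; exact ih.dx

theorem Smooth.D1 {g : SA} (hg : Smooth g) : Smooth (D1 g) := by
  rw [D1_eq]
  exact ⟨hg.2.1, (contDiff_deriv hg.1).neg, hg.2.2.2, (contDiff_deriv hg.2.2.1).neg⟩

theorem Smooth.D2 {g : SA} (hg : Smooth g) : Smooth (D2 g) := by
  rw [D2_eq]
  exact ⟨hg.2.2.1, hg.2.2.2.neg, (contDiff_deriv hg.1).neg, contDiff_deriv hg.2.1⟩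

theorem Smooth.add {f g : SA} (hf : Smooth f) (hg : Smooth g) : Smooth (f + g) :=
  ⟨hf.1.add hg.1, hf.2.1.add hg.2.1, hf.2.2.1.add hg.2.2.1, hf.2.2.2.add hg.2.2.2⟩

theorem Smooth.const_smul {g : SA} (hg : Smooth g) (c : ℂ) : Smooth (c • g) :=
  ⟨contDiff_const.smul hg.1, contDiff_const.smul hg.2.1, contDiff_const.smul hg.2.2.1,
    contDiff_const.smul hg.2.2.2⟩

theorem Smooth.gmul {f g : SA} (hf : Smooth f) (hg : Smooth g) : Smooth (f ⊙ g) := by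
  obtain ⟨f0, f1, f2, f3⟩ := hf
  obtain ⟨g0, g1, g2, g3⟩ := hg
  exact ⟨f0.mul g0, (f0.mul g1).add (f1.mul g0), (f0.mul g2).add (f2.mul g0),
    (((f0.mul g3).add (f3.mul g0)).add (f1.mul g2)).sub (f2.mul g1)⟩

/-! ### Parity -/

theorem Homog.dx {b : Bool} {f : SA} (hf : Homog b f) : Homog b (dx f) := by
  cases b <;> simp_all [Homog, IsEven, IsOdd, SA.dx, a0, a1, a2, a12]

theorem Homog.D1 {b : Bool} {f : SA} (hf : Homog b f) : Homog (!b) (D1 f) := by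
  cases b <;> simp_all [Homog, IsEven, IsOdd, D1_eq, a0, a1, a2, a12]

theorem Homog.D2 {b : Bool} {f : SA} (hf : Homog b f) : Homog (!b) (D2 f) := by
  cases b <;> simp_all [Homog, IsEven, IsOdd, D2_eq, a0, a1, a2, a12]

theorem homog_xi1 : Homog true xi1 := by simp [Homog, IsOdd, xi1, a0, a12]

theorem homog_xi2 : Homog true xi2 := by simp [Homog, IsOdd, xi2, a0, a12]

theorem sgn_not (b : Bool) : sgn (!b) = -sgn b := by cases b <;> simp [sgn]

theorem sgn2_not (b c : Bool) : sgn2 b (!c) = sgn b * sgn2 b c := by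
  cases b <;> cases c <;> simp [sgn, sgn2]

/-! ### Linearity and commutation relations of `∂_x`, `D̄₁`, `D̄₂` -/

theorem dx_add {f g : SA} (hf : Smooth f) (hg : Smooth g) :
    SA.dx (f + g) = SA.dx f + SA.dx g := by
  obtain ⟨f0, f1, f2, f3⟩ := hf
  obtain ⟨g0, g1, g2, g3⟩ := hg
  ext t
  · exact deriv_add (differentiable_of_contDiff f0 t) (differentiable_of_contDiff g0 t)
  · exact deriv_add (differentiable_of_contDiff f1 t) (differentiable_of_contDiff g1 t)
  · exact deriv_add (differentiable_of_contDiff f2 t) (differentiable_of_contDiff g2 t)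
  · exact deriv_add (differentiable_of_contDiff f3 t) (differentiable_of_contDiff g3 t)

theorem dx_smul (c : ℂ) (f : SA) : SA.dx (c • f) = c • SA.dx f := by
  ext t
  · exact deriv_const_smul_field c (a0 f)
  · exact deriv_const_smul_field c (a1 f)
  · exact deriv_const_smul_field c (a2 f)
  · exact deriv_const_smul_field c (a12 f)

theorem iterate_dx_add {f g : SA} (hf : Smooth f) (hg : Smooth g) (k : ℕ) :
    SA.dx^[k] (f + g) = SA.dx^[k] f + SA.dx^[k] g := by
  induction k with
  | zero => rfl
  | succ k ih =>
    simp only [Function.iterate_succ_apply', ih, dx_add (hf.iterate_dx k) (hg.iterate_dx k)]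

theorem iterate_dx_smul (c : ℂ) (f : SA) (k : ℕ) : SA.dx^[k] (c • f) = c • SA.dx^[k] f := by
  induction k with
  | zero => rfl
  | succ k ih => simp only [Function.iterate_succ_apply', ih, dx_smul]

theorem D1_smul (c : ℂ) (f : SA) : D1 (c • f) = c • D1 f := by
  rw [D1, dx_smul, gmul_smul, D1, smul_sub]
  congr 1
  ext t <;> simp [dxi1, a0, a1, a2, a12]

theorem D2_smul (c : ℂ) (f : SA) : D2 (c • f) = c • D2 f := by
  rw [D2, dx_smul, gmul_smul, D2, smul_sub]
  congr 1
  ext t <;> simp [dxi2, a0, a1, a2, a12]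

theorem dxi1_add (f g : SA) : dxi1 (f + g) = dxi1 f + dxi1 g := by
  ext t <;> simp [dxi1, a0, a1, a2, a12]

theorem dxi2_add (f g : SA) : dxi2 (f + g) = dxi2 f + dxi2 g := by
  ext t <;> simp [dxi2, a0, a1, a2, a12, add_comm]

theorem D1_add {f g : SA} (hf : Smooth f) (hg : Smooth g) : D1 (f + g) = D1 f + D1 g := by
  rw [SA.D1, dx_add hf hg, gmul_add, dxi1_add, SA.D1, SA.D1]
  abel

theorem D2_add {f g : SA} (hf : Smooth f) (hg : Smooth g) : D2 (f + g) = D2 f + D2 g := by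
  rw [SA.D2, dx_add hf hg, gmul_add, dxi2_add, SA.D2, SA.D2]
  abel

theorem D1_D1 (g : SA) : D1 (D1 g) = -SA.dx g := by
  ext t <;> simp [D1_eq, SA.dx, a0, a1, a2, a12]

theorem D2_D2 (g : SA) : D2 (D2 g) = -SA.dx g := by
  ext t <;> simp [D2_eq, SA.dx, a0, a1, a2, a12]

theorem D2_D1 (g : SA) : D2 (D1 g) = -D1 (D2 g) := by
  ext t <;> simp [D1_eq, D2_eq, a0, a1, a2, a12]

theorem dx_D1 (g : SA) : SA.dx (D1 g) = D1 (SA.dx g) := by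
  ext t <;> simp [D1_eq, SA.dx, a0, a1, a2, a12]

theorem dx_D2 (g : SA) : SA.dx (D2 g) = D2 (SA.dx g) := by
  ext t <;> simp [D2_eq, SA.dx, a0, a1, a2, a12]

theorem dx_one : SA.dx one = 0 := by
  ext t <;> simp [SA.dx, one, a0, a1, a2, a12]

theorem D1_one : D1 one = 0 := by
  ext t <;> simp [D1_eq, one, a0, a1, a2, a12]

theorem D2_one : D2 one = 0 := by
  ext t <;> simp [D2_eq, one, a0, a1, a2, a12]

/-! ### Leibniz rules -/

theorem dx_gmul {F G : SA} (hF : Smooth F) (hG : Smooth G) :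
    SA.dx (F ⊙ G) = SA.dx F ⊙ G + F ⊙ SA.dx G := by
  have hd {u v : ℝ → ℂ} (hu : ContDiff ℝ (⊤ : ℕ∞) u) (hv : ContDiff ℝ (⊤ : ℕ∞) v) (t : ℝ) :
      HasDerivAt (u * v) (deriv u t * v t + u t * deriv v t) t :=
    (differentiable_of_contDiff hu t).hasDerivAt.mul (differentiable_of_contDiff hv t).hasDerivAt
  obtain ⟨f0, f1, f2, f3⟩ := hF
  obtain ⟨g0, g1, g2, g3⟩ := hG
  ext t
  · exact (hd f0 g0 t).deriv
  · refine ((hd f0 g1 t).add (hd f1 g0 t)).deriv.trans ?_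
    simp only [SA.gmul, SA.dx, a0, a1, a2, a12, Prod.fst_add, Prod.snd_add, Pi.add_apply,
      Pi.mul_apply]
    ring
  · refine ((hd f0 g2 t).add (hd f2 g0 t)).deriv.trans ?_
    simp only [SA.gmul, SA.dx, a0, a1, a2, a12, Prod.fst_add, Prod.snd_add, Pi.add_apply,
      Pi.mul_apply]
    ring
  · refine ((((hd f0 g3 t).add (hd f3 g0 t)).add (hd f1 g2 t)).sub (hd f2 g1 t)).deriv.trans ?_
    simp only [SA.gmul, SA.dx, a0, a1, a2, a12, Prod.snd_add, Pi.add_apply, Pi.mul_apply,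
      Pi.sub_apply]
    ring

theorem dxi1_gmul {b : Bool} {F : SA} (hF : Homog b F) (G : SA) :
    dxi1 (F ⊙ G) = dxi1 F ⊙ G + sgn b • (F ⊙ dxi1 G) := by
  obtain ⟨F0, F1, F2, F3⟩ := F
  cases b <;>
    simp only [Homog, IsEven, IsOdd, a0, a1, a2, a12, if_true, if_false, Bool.false_eq_true]
      at hF <;>
    obtain ⟨rfl, rfl⟩ := hF <;>
    ext t <;> simp [SA.gmul, dxi1, a0, a1, a2, a12, sgn] <;> ring

theorem dxi2_gmul {b : Bool} {F : SA} (hF : Homog b F) (G : SA) :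
    dxi2 (F ⊙ G) = dxi2 F ⊙ G + sgn b • (F ⊙ dxi2 G) := by
  obtain ⟨F0, F1, F2, F3⟩ := F
  cases b <;>
    simp only [Homog, IsEven, IsOdd, a0, a1, a2, a12, if_true, if_false, Bool.false_eq_true]
      at hF <;>
    obtain ⟨rfl, rfl⟩ := hF <;>
    ext t <;> simp [SA.gmul, dxi2, a0, a1, a2, a12, sgn] <;> ring

/-- The super-Leibniz rule for `D̄₁`. -/
theorem D1_gmul {b : Bool} {F G : SA} (hF : Smooth F) (hG : Smooth G) (hb : Homog b F) :
    D1 (F ⊙ G) = D1 F ⊙ G + sgn b • (F ⊙ D1 G) := by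
  have h : xi1 ⊙ (F ⊙ SA.dx G) = sgn b • (F ⊙ (xi1 ⊙ SA.dx G)) := by
    rw [← gmul_assoc, gmul_comm homog_xi1 hb, smul_gmul, gmul_assoc]
    cases b <;> simp [sgn, sgn2]
  rw [SA.D1, dxi1_gmul hb, dx_gmul hF hG, gmul_add, h, SA.D1, SA.D1, sub_gmul, gmul_sub,
    gmul_assoc]
  module

/-- The super-Leibniz rule for `D̄₂`. -/
theorem D2_gmul {b : Bool} {F G : SA} (hF : Smooth F) (hG : Smooth G) (hb : Homog b F) :
    D2 (F ⊙ G) = D2 F ⊙ G + sgn b • (F ⊙ D2 G) := by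
  have h : xi2 ⊙ (F ⊙ SA.dx G) = sgn b • (F ⊙ (xi2 ⊙ SA.dx G)) := by
    rw [← gmul_assoc, gmul_comm homog_xi2 hb, smul_gmul, gmul_assoc]
    cases b <;> simp [sgn, sgn2]
  rw [SA.D2, dxi2_gmul hb, dx_gmul hF hG, gmul_add, h, SA.D2, SA.D2, sub_gmul, gmul_sub,
    gmul_assoc]
  module

/-! ### The action on densities -/

theorem Lden_eq (b : Bool) (h : SA) (lam : ℂ) (g : SA) :
    Lden b h lam g = h ⊙ SA.dx g + (-(sgn b * 2⁻¹)) • (D1 h ⊙ D1 g + D2 h ⊙ D2 g)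
      + lam • (SA.dx h ⊙ g) := by
  rw [Lden, XV, sub_eq_add_neg, ← neg_smul]

theorem Smooth.Lden {h g : SA} (hh : Smooth h) (hg : Smooth g) (bh : Bool) (lam : ℂ) :
    Smooth (Lden bh h lam g) := by
  rw [Lden_eq]
  exact ((hh.gmul hg.dx).add (((hh.D1.gmul hg.D1).add (hh.D2.gmul hg.D2)).const_smul _)).add
    ((hh.dx.gmul hg).const_smul _)

theorem Lden_add (bh : Bool) (h : SA) (mu : ℂ) {f g : SA} (hf : Smooth f) (hg : Smooth g) :
    Lden bh h mu (f + g) = Lden bh h mu f + Lden bh h mu g := by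
  simp only [Lden, XV, dx_add hf hg, D1_add hf hg, D2_add hf hg, gmul_add, smul_add]
  abel

/-- The super-Leibniz rule for the action on densities. -/
theorem Lden_gmul {bh : Bool} {h : SA} (hh : Homog bh h) {bF : Bool} {F G : SA}
    (hF : Smooth F) (hG : Smooth G) (hpF : Homog bF F) (mu nu : ℂ) :
    Lden bh h mu (F ⊙ G)
      = Lden bh h (mu - nu) F ⊙ G + sgn2 bh bF • (F ⊙ Lden bh h nu G) := by
  have e0 : h ⊙ (F ⊙ SA.dx G) = sgn2 bh bF • (F ⊙ (h ⊙ SA.dx G)) := by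
    rw [← gmul_assoc, gmul_comm hh hpF, smul_gmul, gmul_assoc]
  have e1 : D1 h ⊙ (F ⊙ D1 G) = sgn2 (!bh) bF • (F ⊙ (D1 h ⊙ D1 G)) := by
    rw [← gmul_assoc, gmul_comm hh.D1 hpF, smul_gmul, gmul_assoc]
  have e2 : D2 h ⊙ (F ⊙ D2 G) = sgn2 (!bh) bF • (F ⊙ (D2 h ⊙ D2 G)) := by
    rw [← gmul_assoc, gmul_comm hh.D2 hpF, smul_gmul, gmul_assoc]
  have e3 : F ⊙ (SA.dx h ⊙ G) = sgn2 bh bF • (SA.dx h ⊙ (F ⊙ G)) := by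
    rw [← gmul_assoc, gmul_comm hpF hh.dx, smul_gmul, gmul_assoc]
    cases bh <;> cases bF <;> simp [sgn2]
  simp only [Lden, XV, dx_gmul hF hG, D1_gmul hF hG hpF, D2_gmul hF hG hpF, gmul_add, gmul_smul,
    add_gmul, sub_gmul, smul_gmul, gmul_sub, gmul_assoc, e0, e1, e2, e3]
  cases bh <;> cases bF <;> simp only [sgn, sgn2, Bool.not_true, Bool.not_false, Bool.and_true,
    Bool.and_false, if_true, if_false, Bool.false_eq_true] <;> module

/-! ### The affine Hamiltonians -/

theorem inAff.homog {bh : Bool} {h : SA} (H : inAff bh h) : Homog bh h := by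
  rcases H with ⟨rfl, rfl | rfl | rfl⟩ | ⟨rfl, rfl | rfl⟩ <;>
    simp [Homog, IsEven, IsOdd, one, xx, xi1, xi2, SA.gmul, a0, a1, a2, a12]

theorem inAff.smooth {bh : Bool} {h : SA} (H : inAff bh h) : Smooth h := by
  have h0 : ContDiff ℝ (⊤ : ℕ∞) (0 : ℝ → ℂ) := contDiff_const
  have h1 : ContDiff ℝ (⊤ : ℕ∞) (1 : ℝ → ℂ) := contDiff_const
  have s1 : Smooth xi1 := ⟨h0, h1, h0, h0⟩
  have s2 : Smooth xi2 := ⟨h0, h0, h1, h0⟩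
  rcases H with ⟨rfl, rfl | rfl | rfl⟩ | ⟨rfl, rfl | rfl⟩
  · exact ⟨h1, h0, h0, h0⟩
  · exact ⟨Complex.ofRealCLM.contDiff, h0, h0, h0⟩
  · exact s1.gmul s2
  · exact s1
  · exact s2

theorem deriv_ofReal_coe : deriv (fun t : ℝ => (t : ℂ)) = 1 :=
  funext fun _ => Complex.ofRealCLM.hasDerivAt.deriv

/-- The derivative of an affine Hamiltonian is constant, and vanishes in the odd case. -/
theorem inAff.dx_eq {bh : Bool} {h : SA} (H : inAff bh h) :
    ∃ a : ℂ, SA.dx h = a • one ∧ sgn bh * a = a := by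
  rcases H with ⟨rfl, rfl | rfl | rfl⟩ | ⟨rfl, rfl | rfl⟩
  · exact ⟨0, by ext t <;> simp [SA.dx, one, a0, a1, a2, a12], by simp⟩
  · exact ⟨1, by ext t <;> simp [SA.dx, xx, one, a0, a1, a2, a12, deriv_ofReal_coe],
      by simp [sgn]⟩
  · exact ⟨0, by ext t <;> simp [SA.dx, xi1, xi2, SA.gmul, a0, a1, a2, a12], by simp⟩
  · exact ⟨0, by ext t <;> simp [SA.dx, xi1, a0, a1, a2, a12], by simp⟩
  · exact ⟨0, by ext t <;> simp [SA.dx, xi2, a0, a1, a2, a12], by simp⟩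

/-- `D̄₁D̄₂(h)` is constant for an affine Hamiltonian `h`, and vanishes in the odd case. -/
theorem inAff.D1_D2_eq {bh : Bool} {h : SA} (H : inAff bh h) :
    ∃ c : ℂ, D1 (D2 h) = c • one ∧ sgn bh * c = c := by
  rcases H with ⟨rfl, rfl | rfl | rfl⟩ | ⟨rfl, rfl | rfl⟩
  · exact ⟨0, by ext t <;> simp [D1_eq, D2_eq, one, a0, a1, a2, a12], by simp⟩
  · exact ⟨0, by ext t <;> simp [D1_eq, D2_eq, xx, a0, a1, a2, a12, deriv_ofReal_coe], by simp⟩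
  · exact ⟨-1, by ext t <;> simp [D1_eq, D2_eq, xi1, xi2, SA.gmul, one, a0, a1, a2, a12],
      by simp [sgn]⟩
  · exact ⟨0, by ext t <;> simp [D1_eq, D2_eq, xi1, a0, a1, a2, a12], by simp⟩
  · exact ⟨0, by ext t <;> simp [D1_eq, D2_eq, xi2, a0, a1, a2, a12], by simp⟩

theorem inAff.dx_Lden {bh : Bool} {h : SA} (H : inAff bh h) {g : SA} (hg : Smooth g) (lam : ℂ) :
    SA.dx (Lden bh h lam g) = Lden bh h (lam + 1) (SA.dx g) := by
  have hh := H.smooth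
  obtain ⟨a, ha, -⟩ := H.dx_eq
  have s1 := hh.D1.gmul hg.D1
  have s2 := hh.D2.gmul hg.D2
  rw [Lden_eq, Lden_eq, dx_add ((hh.gmul hg.dx).add ((s1.add s2).const_smul _))
    ((hh.dx.gmul hg).const_smul _), dx_add (hh.gmul hg.dx) ((s1.add s2).const_smul _), dx_smul,
    dx_smul, dx_add s1 s2, dx_gmul hh hg.dx, dx_gmul hh.D1 hg.D1, dx_gmul hh.D2 hg.D2,
    dx_gmul hh.dx hg]
  simp only [dx_D1, dx_D2, ha, dx_smul, D1_smul, D2_smul, dx_one, D1_one, D2_one, smul_zero,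
    zero_gmul, smul_gmul, one_gmul, zero_add]
  module

theorem inAff.D1_Lden {bh : Bool} {h : SA} (H : inAff bh h) {c : ℂ} (hc : D1 (D2 h) = c • one)
    {g : SA} (hg : Smooth g) (lam : ℂ) :
    D1 (Lden bh h lam g)
      = sgn bh • (Lden bh h (lam + 2⁻¹) (D1 g) + (-(2⁻¹ * c)) • D2 g) := by
  have hh := H.smooth
  have hp := H.homog
  obtain ⟨a, ha, hsa⟩ := H.dx_eq
  have s1 := hh.D1.gmul hg.D1
  have s2 := hh.D2.gmul hg.D2
  rw [Lden_eq, Lden_eq, D1_add ((hh.gmul hg.dx).add ((s1.add s2).const_smul _))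
    ((hh.dx.gmul hg).const_smul _), D1_add (hh.gmul hg.dx) ((s1.add s2).const_smul _), D1_smul,
    D1_smul, D1_add s1 s2, D1_gmul hh hg.dx hp, D1_gmul hh.D1 hg.D1 hp.D1,
    D1_gmul hh.D2 hg.D2 hp.D2, D1_gmul hh.dx hg hp.dx]
  simp only [D1_D1, D2_D1, dx_D1, ha, hc, D1_smul, D1_one, smul_zero, zero_gmul, smul_gmul,
    one_gmul, zero_add, gmul_neg, neg_gmul, sgn_not]
  cases bh <;> simp only [sgn, if_true, if_false, Bool.false_eq_true] at hsa ⊢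
  · module
  · obtain rfl : a = 0 := by linear_combination (-1 / 2 : ℂ) * hsa
    module

theorem inAff.D2_Lden {bh : Bool} {h : SA} (H : inAff bh h) {c : ℂ} (hc : D1 (D2 h) = c • one)
    {g : SA} (hg : Smooth g) (lam : ℂ) :
    D2 (Lden bh h lam g)
      = sgn bh • (Lden bh h (lam + 2⁻¹) (D2 g) + (2⁻¹ * c) • D1 g) := by
  have hh := H.smooth
  have hp := H.homog
  obtain ⟨a, ha, hsa⟩ := H.dx_eq
  have s1 := hh.D1.gmul hg.D1
  have s2 := hh.D2.gmul hg.D2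
  rw [Lden_eq, Lden_eq, D2_add ((hh.gmul hg.dx).add ((s1.add s2).const_smul _))
    ((hh.dx.gmul hg).const_smul _), D2_add (hh.gmul hg.dx) ((s1.add s2).const_smul _), D2_smul,
    D2_smul, D2_add s1 s2, D2_gmul hh hg.dx hp, D2_gmul hh.D1 hg.D1 hp.D1,
    D2_gmul hh.D2 hg.D2 hp.D2, D2_gmul hh.dx hg hp.dx]
  simp only [D2_D2, D2_D1, dx_D2, ha, hc, D2_smul, D2_one, smul_zero, zero_gmul, smul_gmul,
    one_gmul, zero_add, gmul_neg, neg_gmul, sgn_not]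
  cases bh <;> simp only [sgn, if_true, if_false, Bool.false_eq_true] at hsa ⊢
  · module
  · obtain rfl : a = 0 := by linear_combination (-1 / 2 : ℂ) * hsa
    module

theorem inAff.iterate_dx_Lden {bh : Bool} {h : SA} (H : inAff bh h) {g : SA} (hg : Smooth g)
    (lam : ℂ) (k : ℕ) :
    SA.dx^[k] (Lden bh h lam g) = Lden bh h (lam + k) (SA.dx^[k] g) := by
  induction k with
  | zero => simp
  | succ k ih =>
    simp only [Function.iterate_succ_apply', ih, H.dx_Lden (hg.iterate_dx k)]
    push_cast
    rw [add_assoc]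

theorem inAff.D1_D2_Lden {bh : Bool} {h : SA} (H : inAff bh h) {g : SA} (hg : Smooth g)
    (lam : ℂ) : D1 (D2 (Lden bh h lam g)) = Lden bh h (lam + 1) (D1 (D2 g)) := by
  obtain ⟨c, hc, hsc⟩ := H.D1_D2_eq
  have hl : lam + 2⁻¹ + 2⁻¹ = lam + 1 := by ring
  rw [H.D2_Lden hc hg, D1_smul, D1_add (H.smooth.Lden hg.D2 _ _) (hg.D1.const_smul _),
    H.D1_Lden hc hg.D2, D1_smul, D1_D1, D2_D2, hl]
  cases bh <;> simp only [sgn, if_true, if_false, Bool.false_eq_true] at hsc ⊢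
  · module
  · obtain rfl : c = 0 := by linear_combination (-1 / 2 : ℂ) * hsc
    module

end SA

/-- Affine equivariance of the naive quantization: for the
affine contact Hamiltonians `h ∈ {1, x, ξ₁ξ₂, ξ₁, ξ₂}` the symbol-action
identities hold *exactly* (with no lower-order remainder), for integer and
half-integer contact order alike. -/
theorem statement9 :
    ∀ (lam mu : ℂ) (bh : Bool) (h : SA), inAff bh h →
    ∀ (bF : Bool) (F1 F2 : SA),
      Smooth F1 → Smooth F2 → Homog bF F1 → Homog bF F2 →
      (∀ (k : ℕ), 1 ≤ k → ∀ g, Smooth g →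
        LieD bh h lam mu bF
          (fun u => F1 ⊙ dx^[k] u + F2 ⊙ dx^[k-1] (D1 (D2 u))) g
        = Lden bh h (mu - lam - (k : ℂ)) F1 ⊙ dx^[k] g
          + Lden bh h (mu - lam - (k : ℂ)) F2 ⊙ dx^[k-1] (D1 (D2 g))) ∧
      (∀ (l : ℕ), ∀ g, Smooth g →
        LieD bh h lam mu (!bF)
          (fun u => F1 ⊙ dx^[l] (D1 u) + F2 ⊙ dx^[l] (D2 u)) g
        = (Lden bh h (mu - lam - (l : ℂ) - 2⁻¹) F1 - (2 : ℂ)⁻¹ • (D1 (D2 h) ⊙ F2))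
              ⊙ dx^[l] (D1 g)
          + (Lden bh h (mu - lam - (l : ℂ) - 2⁻¹) F2 + (2 : ℂ)⁻¹ • (D1 (D2 h) ⊙ F1))
              ⊙ dx^[l] (D2 g)) := by
  intro lam mu bh h H bF F1 F2 hF1 hF2 hp1 hp2
  have hh := H.smooth
  have hp := H.homog
  refine ⟨fun k hk g hg => ?_, fun l g hg => ?_⟩
  · obtain ⟨k, rfl⟩ := Nat.exists_eq_add_of_le' hk
    have hA := hg.iterate_dx (k + 1)
    have hB := hg.D2.D1.iterate_dx k
    have hw : lam + 1 + (k : ℂ) = lam + ((k + 1 : ℕ) : ℂ) := by push_cast; ring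
    simp only [LieD, Nat.add_sub_cancel]
    rw [Lden_add bh h mu (hF1.gmul hA) (hF2.gmul hB),
      Lden_gmul hp hF1 hA hp1 mu (lam + ((k + 1 : ℕ) : ℂ)),
      Lden_gmul hp hF2 hB hp2 mu (lam + ((k + 1 : ℕ) : ℂ)), H.iterate_dx_Lden hg,
      H.D1_D2_Lden hg, H.iterate_dx_Lden hg.D2.D1, hw, sub_sub]
    module
  · obtain ⟨c, hc, hsc⟩ := H.D1_D2_eq
    have hA := hg.D1.iterate_dx l
    have hB := hg.D2.iterate_dx l
    have hw : mu - lam - (l : ℂ) - 2⁻¹ = mu - (lam + 2⁻¹ + l) := by ring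
    simp only [LieD]
    rw [Lden_add bh h mu (hF1.gmul hA) (hF2.gmul hB),
      Lden_gmul hp hF1 hA hp1 mu (lam + 2⁻¹ + l), Lden_gmul hp hF2 hB hp2 mu (lam + 2⁻¹ + l),
      H.D1_Lden hc hg, H.D2_Lden hc hg, iterate_dx_smul, iterate_dx_smul,
      iterate_dx_add (hh.Lden hg.D1 _ _) (hg.D2.const_smul _),
      iterate_dx_add (hh.Lden hg.D2 _ _) (hg.D1.const_smul _), iterate_dx_smul, iterate_dx_smul,
      H.iterate_dx_Lden hg.D1, H.iterate_dx_Lden hg.D2, hw, hc, sgn2_not]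
    simp only [gmul_smul, gmul_add, sub_gmul, add_gmul, smul_gmul, one_gmul]
    cases bh <;> simp only [sgn, sgn2, Bool.true_and, Bool.false_and, if_true, if_false,
      Bool.false_eq_true] at hsc ⊢
    · module
    · obtain rfl : c = 0 := by linear_combination (-1 / 2 : ℂ) * hsc
      module
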